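/- There exist a real constant C > 0 and an integer n₀ such that for every integer n > n₀ and every integer t satisfying n − 2 ≤ t and t ≤ n²/2 − C·n·log n, there exists a saturated blocker of the convex n-gon consisting of exactly t edges. -/

import Mathlib

open Finset

namespace ConvexBlocker

/-- `c` lies strictly inside the (positively oriented) open arc from `a` to `b`. -/
def Btw (n : ℕ) (a c b : ZMod n) : Prop :=
  0 < (c - a).val ∧ (c - a).val < (b - a).val

/-- Two edges of the convex `n`-gon cross: their endpoints are four pairwise distinct
vertices which interleave in the cyclic order. -/
def Cross (n : ℕ) (e f : Sym2 (ZMod n)) : Prop :=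
  ∃ a b c d : ZMod n, e = s(a, b) ∧ f = s(c, d) ∧
    0 < (c - a).val ∧ (c - a).val < (b - a).val ∧ (b - a).val < (d - a).val

/-- `e` is an edge (an unordered pair of distinct vertices) of the `n`-gon. -/
def IsEdge (n : ℕ) (e : Sym2 (ZMod n)) : Prop :=
  ∃ a b : ZMod n, e = s(a, b) ∧ a ≠ b

/-- `e` is a diagonal of the convex `n`-gon: an edge of order at least 2, i.e. both open
arcs between its endpoints are nonempty. -/
def IsDiagonal (n : ℕ) (e : Sym2 (ZMod n)) : Prop :=
  ∃ a b : ZMod n, e = s(a, b) ∧ a ≠ b ∧ (∃ c, Btw n a c b) ∧ (∃ d, Btw n b d a)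

/-- A triangulation of the convex `n`-gon: an inclusion-maximal set of pairwise
non-crossing diagonals. -/
def IsTriangulation (n : ℕ) (T : Finset (Sym2 (ZMod n))) : Prop :=
  (∀ e ∈ T, IsDiagonal n e) ∧
  (∀ e ∈ T, ∀ f ∈ T, ¬ Cross n e f) ∧
  (∀ e, IsDiagonal n e → e ∉ T → ∃ f ∈ T, Cross n e f)

/-- A blocker of the convex `n`-gon: a set of edges meeting every triangulation. -/
def IsBlocker (n : ℕ) (B : Finset (Sym2 (ZMod n))) : Prop :=
  (∀ e ∈ B, IsEdge n e) ∧
  ∀ T : Finset (Sym2 (ZMod n)), IsTriangulation n T → (B ∩ T).Nonempty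

/-- A saturated blocker of the convex `n`-gon. -/
def IsSaturatedBlocker (n : ℕ) (B : Finset (Sym2 (ZMod n))) : Prop :=
  IsBlocker n B ∧ ∀ e ∈ B, ¬ IsBlocker n (B.erase e)

/-- `e` is an edge of the sub-polygon on the vertex set `S`. -/
def IsEdgeOn (n : ℕ) (S : Finset (ZMod n)) (e : Sym2 (ZMod n)) : Prop :=
  ∃ a b : ZMod n, e = s(a, b) ∧ a ∈ S ∧ b ∈ S ∧ a ≠ b

/-- `e` is a diagonal of the sub-polygon on `S` (with the inherited cyclic order):
its endpoints are distinct members of `S` which are not cyclically consecutive in `S`. -/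
def IsDiagonalOn (n : ℕ) (S : Finset (ZMod n)) (e : Sym2 (ZMod n)) : Prop :=
  ∃ a b : ZMod n, e = s(a, b) ∧ a ∈ S ∧ b ∈ S ∧ a ≠ b ∧
    (∃ c ∈ S, Btw n a c b) ∧ (∃ d ∈ S, Btw n b d a)

/-- A triangulation of the sub-polygon on `S`. -/
def IsTriangulationOn (n : ℕ) (S : Finset (ZMod n)) (T : Finset (Sym2 (ZMod n))) : Prop :=
  (∀ e ∈ T, IsDiagonalOn n S e) ∧
  (∀ e ∈ T, ∀ f ∈ T, ¬ Cross n e f) ∧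
  (∀ e, IsDiagonalOn n S e → e ∉ T → ∃ f ∈ T, Cross n e f)

/-- A blocker of the sub-polygon on `S`. -/
def IsBlockerOn (n : ℕ) (S : Finset (ZMod n)) (B : Finset (Sym2 (ZMod n))) : Prop :=
  (∀ e ∈ B, IsEdgeOn n S e) ∧
  ∀ T : Finset (Sym2 (ZMod n)), IsTriangulationOn n S T → (B ∩ T).Nonempty

/-- A saturated blocker of the sub-polygon on `S`. -/
def IsSaturatedBlockerOn (n : ℕ) (S : Finset (ZMod n)) (B : Finset (Sym2 (ZMod n))) : Prop :=
  IsBlockerOn n S B ∧ ∀ e ∈ B, ¬ IsBlockerOn n S (B.erase e)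

/-- The degree of the vertex `v` in the set of edges `B`. -/
noncomputable def degB (n : ℕ) (B : Finset (Sym2 (ZMod n))) (v : ZMod n) : ℕ :=
  (B.filter (fun e => v ∈ e)).card

end ConvexBlocker

/-!
### Chord sets on an interval

A set `B` of chords `(i, j)`, `i < j`, of the polygon on `0, …, n - 1` is studied through the
root edge `{0, n - 1}`: a chord outside `B` whose inner side can be triangulated without `B`
is an *arc*.
-/

namespace ConvexBlocker

/-- `Arc B i j`: the pair `(i, j)` is a unit step, or a chord outside `B` such that the polygon
on `i, …, j` has a triangulation avoiding `B`. -/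
inductive Arc (B : Finset (ℕ × ℕ)) : ℕ → ℕ → Prop
  | unit (i : ℕ) : Arc B i (i + 1)
  | join {i k j : ℕ} : Arc B i k → Arc B k j → (i, j) ∉ B → Arc B i j

/-- The polygon on `i, …, j` has a triangulation avoiding `B`, and at least three vertices. -/
def Split (B : Finset (ℕ × ℕ)) (i j : ℕ) : Prop := ∃ k, Arc B i k ∧ Arc B k j

/-- `Outer B r s i j`: the polygon on `r, …, i, j, …, s` has a triangulation avoiding `B`. -/
inductive Outer (B : Finset (ℕ × ℕ)) (r s : ℕ) : ℕ → ℕ → Prop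
  | root : Outer B r s r s
  | left {i' i j : ℕ} : Outer B r s i' j → (i', j) ∉ B → Arc B i' i → i < j → Outer B r s i j
  | right {i j j' : ℕ} : Outer B r s i j' → (i, j') ∉ B → Arc B j j' → i < j → Outer B r s i j

/-- `B` is a set of diagonals of the polygon on `0, …, n - 1`, each of which can be completed to
a triangulation by diagonals outside `B`. -/
structure Healing (n : ℕ) (B : Finset (ℕ × ℕ)) : Prop where
  five_le : 5 ≤ n
  diag : ∀ i j, (i, j) ∈ B → i + 2 ≤ j ∧ j < n ∧ ¬ (i = 0 ∧ j = n - 1)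
  split : ∀ i j, (i, j) ∈ B → Split B i j
  outer : ∀ i j, (i, j) ∈ B → Outer B 0 (n - 1) i j

/-- A healing set of diagonals for which the only arc leaving `0` is the unit step. Such a set
meets every triangulation. -/
structure LeftClean (n : ℕ) (B : Finset (ℕ × ℕ)) : Prop extends Healing n B where
  clean : ∀ j, Arc B 0 j → j < n → j = 1

/-- A healing set of diagonals for which the only arc arriving at `n - 1` is the unit step. -/
structure RightClean (n : ℕ) (B : Finset (ℕ × ℕ)) : Prop extends Healing n B where
  clean : ∀ i, Arc B i (n - 1) → i + 2 = n

variable {B B' : Finset (ℕ × ℕ)}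

theorem Arc.lt {i j : ℕ} (h : Arc B i j) : i < j := by
  induction h with
  | unit i => omega
  | join _ _ _ h1 h2 => omega

theorem Arc.of_eq {i j : ℕ} (h : j = i + 1) : Arc B i j := h ▸ Arc.unit i

theorem Arc.mono {i j : ℕ} (hB : B' ⊆ B) (h : Arc B i j) : Arc B' i j := by
  induction h with
  | unit i => exact .unit i
  | join _ _ h h1 h2 => exact .join h1 h2 fun h' => h (hB h')

theorem Arc.split {i j : ℕ} (h : Arc B i j) (hij : i + 2 ≤ j) : Split B i j := by
  cases h with
  | unit => omega
  | join h1 h2 _ => exact ⟨_, h1, h2⟩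

theorem Arc.fan_left {i j : ℕ} (hij : i < j) (h : ∀ k, i + 2 ≤ k → k ≤ j → (i, k) ∉ B) :
    Arc B i j := by
  induction j, hij using Nat.le_induction with
  | base => exact .unit i
  | succ j hj ih =>
    exact .join (ih fun k h1 h2 => h k h1 (by omega)) (.unit j) (h _ (by omega) le_rfl)

theorem Arc.fan_right {i j : ℕ} (hij : i < j) (h : ∀ k, i ≤ k → k + 2 ≤ j → (k, j) ∉ B) :
    Arc B i j := by
  obtain ⟨d, rfl⟩ := Nat.exists_eq_add_of_lt hij
  induction d generalizing i with
  | zero => exact .unit i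
  | succ d ih =>
    refine .join (.unit i) ?_ (h i le_rfl (by omega))
    have h1 := ih (i := i + 1) (by omega)
    rw [show i + (d + 1) + 1 = i + 1 + d + 1 by ring] at h ⊢
    exact h1 fun k hk hk' => h k (by omega) hk'

theorem Arc.embed {i j n d : ℕ} (h : Arc B i j)
    (hB : ∀ i j, (i, j) ∉ B → j < n → (i + d, j + d) ∉ B') (hj : j < n) :
    Arc B' (i + d) (j + d) := by
  induction h with
  | unit i => exact .of_eq (by omega)
  | join h1 h2 h ih1 ih2 =>
    exact .join (ih1 (h2.lt.trans hj)) (ih2 hj) (hB _ _ h hj)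

theorem Split.embed {i j n d : ℕ} (h : Split B i j)
    (hB : ∀ i j, (i, j) ∉ B → j < n → (i + d, j + d) ∉ B') (hj : j < n) :
    Split B' (i + d) (j + d) := by
  obtain ⟨k, h1, h2⟩ := h
  exact ⟨k + d, h1.embed hB (h2.lt.trans hj), h2.embed hB hj⟩

theorem Outer.le {r s i j : ℕ} (h : Outer B r s i j) : j ≤ s := by
  induction h with
  | root => exact le_rfl
  | left _ _ _ _ ih => exact ih
  | right _ _ h _ ih => exact h.lt.le.trans ih

theorem Outer.embed {i j n d r s : ℕ} (h : Outer B 0 (n - 1) i j) (hn : 0 < n)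
    (hB : ∀ i j, (i, j) ∉ B → j < n → (i + d, j + d) ∉ B')
    (hr : Outer B' r s d (n - 1 + d)) : Outer B' r s (i + d) (j + d) := by
  induction h with
  | root => simpa using hr
  | left h hB' ha hij ih =>
    have := h.le
    exact .left ih (hB _ _ hB' (by omega)) (ha.embed hB (by omega)) (by omega)
  | right h hB' ha hij ih =>
    have := h.le
    exact .right ih (hB _ _ hB' (by omega)) (ha.embed hB (by omega)) (by omega)

theorem Outer.fan {r s i j j' : ℕ} (h : Outer B r s i j') (hij : i < j) (hj : j ≤ j')
    (hB : ∀ k, j < k → k ≤ j' → (i, k) ∉ B) : Outer B r s i j := by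
  obtain ⟨d, rfl⟩ := Nat.exists_eq_add_of_le hj
  induction d with
  | zero => exact h
  | succ d ih =>
    exact ih (.right h (hB _ (by omega) le_rfl) (.unit _) (by omega)) (by omega)
      fun k h1 h2 => hB k h1 (by omega)

theorem Outer.arc {r s i j : ℕ} (h : Outer B r s i j) (hB : B' ⊆ B) (ha : Arc B' i j) :
    Arc B' r s := by
  induction h with
  | root => exact ha
  | left _ hB' h _ ih => exact ih (.join (h.mono hB) ha fun h' => hB' (hB h'))
  | right _ hB' h _ ih => exact ih (.join ha (h.mono hB) fun h' => hB' (hB h'))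

/-- Releasing one chord of a healing set makes the whole polygon triangulable. -/
theorem Healing.split_erase {n i j : ℕ} (h : Healing n B) (hij : (i, j) ∈ B) :
    Split (B.erase (i, j)) 0 (n - 1) := by
  have hB := Finset.erase_subset (i, j) B
  obtain ⟨k, h1, h2⟩ := h.split i j hij
  have ha : Arc (B.erase (i, j)) i j :=
    .join (h1.mono hB) (h2.mono hB) (Finset.notMem_erase _ _)
  have := h.five_le
  exact ((h.outer i j hij).arc hB ha).split (by omega)

theorem LeftClean.not_split {n : ℕ} (h : LeftClean n B) : ¬ Split B 0 (n - 1) := by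
  rintro ⟨k, h1, h2⟩
  have := h.five_le
  have h3 := h.clean _ (.join h1 h2 fun h' => (h.diag _ _ h').2.2 ⟨rfl, rfl⟩) (by omega)
  omega

/-! ### Reflection -/

/-- The image of a chord set under the reflection `i ↦ n - 1 - i`. -/
def mirror (n : ℕ) (B : Finset (ℕ × ℕ)) : Finset (ℕ × ℕ) :=
  B.image fun e => (n - 1 - e.2, n - 1 - e.1)

theorem mem_mirror {n : ℕ} (hB : ∀ i j, (i, j) ∈ B → i < j ∧ j < n) {i j : ℕ} :
    (i, j) ∈ mirror n B ↔ i < n ∧ j < n ∧ (n - 1 - j, n - 1 - i) ∈ B := by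
  simp only [mirror, Finset.mem_image, Prod.mk.injEq, Prod.exists]
  constructor
  · rintro ⟨a, b, h, rfl, rfl⟩
    have := hB _ _ h
    rw [show n - 1 - (n - 1 - a) = a by omega, show n - 1 - (n - 1 - b) = b by omega]
    exact ⟨by omega, by omega, h⟩
  · rintro ⟨hi, hj, h⟩
    exact ⟨_, _, h, by omega, by omega⟩

theorem card_mirror {n : ℕ} (hB : ∀ i j, (i, j) ∈ B → i < j ∧ j < n) :
    (mirror n B).card = B.card := by
  apply Finset.card_image_of_injOn
  rintro ⟨a, b⟩ h1 ⟨c, d⟩ h2 h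
  have := hB _ _ h1
  have := hB _ _ h2
  simp only [Prod.mk.injEq] at h ⊢
  omega

theorem Arc.reflect {n i j : ℕ} (h : Arc B i j)
    (hB : ∀ i j, (i, j) ∉ B → j < n → (n - 1 - j, n - 1 - i) ∉ B') (hj : j < n) :
    Arc B' (n - 1 - j) (n - 1 - i) := by
  induction h with
  | unit i => exact .of_eq (by omega)
  | join h1 h2 h ih1 ih2 =>
    exact .join (ih2 hj) (ih1 (h2.lt.trans hj)) (hB _ _ h hj)

theorem Outer.reflect {n i j : ℕ} (h : Outer B 0 (n - 1) i j) (hn : 0 < n)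
    (hB : ∀ i j, (i, j) ∉ B → j < n → (n - 1 - j, n - 1 - i) ∉ B') :
    Outer B' 0 (n - 1) (n - 1 - j) (n - 1 - i) := by
  induction h with
  | root => simpa using Outer.root
  | left h hB' ha hij ih =>
    have := h.le
    exact .right ih (hB _ _ hB' (by omega)) (ha.reflect hB (by omega)) (by omega)
  | right h hB' ha hij ih =>
    have := h.le
    have := ha.lt
    exact .left ih (hB _ _ hB' (by omega)) (ha.reflect hB (by omega)) (by omega)

theorem LeftClean.mirror {n : ℕ} (h : LeftClean n B) : RightClean n (mirror n B) := by
  have hn := h.five_le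
  have hmem := @mem_mirror B n fun i j hij => by have := h.diag i j hij; omega
  have hB : ∀ i j, (i, j) ∉ B → j < n → (n - 1 - j, n - 1 - i) ∉ ConvexBlocker.mirror n B := by
    intro i j hij hj h'
    obtain ⟨h1, h2, h3⟩ := hmem.1 h'
    by_cases hi : i < n
    · rw [show n - 1 - (n - 1 - j) = j by omega, show n - 1 - (n - 1 - i) = i by omega] at h3
      exact hij h3
    · have := h.diag _ _ h3
      omega
  have hB' : ∀ i j, (i, j) ∉ ConvexBlocker.mirror n B → j < n → (n - 1 - j, n - 1 - i) ∉ B := by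
    intro i j hij hj h'
    have := h.diag _ _ h'
    exact hij (hmem.2 ⟨by omega, hj, h'⟩)
  refine ⟨⟨hn, ?_, ?_, ?_⟩, ?_⟩
  · intro i j hij
    obtain ⟨h1, h2, h3⟩ := hmem.1 hij
    have := h.diag _ _ h3
    omega
  · intro i j hij
    obtain ⟨h1, h2, h3⟩ := hmem.1 hij
    obtain ⟨k, h4, h5⟩ := h.split _ _ h3
    have h4' := h4.reflect hB (h5.lt.trans (by omega))
    have h5' := h5.reflect hB (by omega)
    rw [show n - 1 - (n - 1 - j) = j by omega] at h4'
    rw [show n - 1 - (n - 1 - i) = i by omega] at h5'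
    exact ⟨_, h5', h4'⟩
  · intro i j hij
    obtain ⟨h1, h2, h3⟩ := hmem.1 hij
    have h4 := (h.outer _ _ h3).reflect (by omega) hB
    rwa [show n - 1 - (n - 1 - j) = j by omega, show n - 1 - (n - 1 - i) = i by omega] at h4
  · intro i hi
    have h1 := hi.reflect hB' (by omega)
    rw [Nat.sub_self] at h1
    have := hi.lt
    have := h.clean _ h1 (by omega)
    omega

/-! ### Constructions -/

/-- The image of a chord set under the translation by `d`. -/
def shift (d : ℕ) (B : Finset (ℕ × ℕ)) : Finset (ℕ × ℕ) := B.image fun e => (e.1 + d, e.2 + d)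

theorem mem_shift {d i j : ℕ} : (i, j) ∈ shift d B ↔ d ≤ i ∧ d ≤ j ∧ (i - d, j - d) ∈ B := by
  simp only [shift, Finset.mem_image, Prod.mk.injEq, Prod.exists]
  constructor
  · rintro ⟨a, b, h, rfl, rfl⟩
    simpa using h
  · rintro ⟨hi, hj, h⟩
    exact ⟨_, _, h, by omega, by omega⟩

theorem card_shift (d : ℕ) (B : Finset (ℕ × ℕ)) : (shift d B).card = B.card := by
  apply Finset.card_image_of_injective
  rintro ⟨a, b⟩ ⟨c, e⟩ h
  simpa using h

/-- Attaching an ear in front of a left-clean set. -/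
theorem LeftClean.ear {n : ℕ} (h : LeftClean n B) :
    LeftClean (n + 1) (insert (0, 2) (shift 1 B)) := by
  have hn := h.five_le
  set B' := insert (0, 2) (shift 1 B) with hB'
  have hmem : ∀ i j, (i, j) ∈ B' ↔
      (i = 0 ∧ j = 2) ∨ (1 ≤ i ∧ 1 ≤ j ∧ (i - 1, j - 1) ∈ B) := by
    intro i j
    rw [hB', Finset.mem_insert, mem_shift, Prod.mk.injEq]
  have hemb : ∀ i j, (i, j) ∉ B → j < n → (i + 1, j + 1) ∉ B' := by
    intro i j hij _ h'
    rw [hmem] at h'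
    rcases h' with h' | h'
    · omega
    · exact hij h'.2.2
  have hfirst : Outer B' 0 (n + 1 - 1) 1 (n - 1 + 1) := by
    rw [show n - 1 + 1 = n + 1 - 1 by omega]
    exact .left .root (by rw [hmem]; omega) (.unit 0) (by omega)
  have hfan : Outer B' 0 (n + 1 - 1) 0 2 :=
    .fan .root (by omega) (by omega) fun k _ _ => by rw [hmem]; omega
  have harc : ∀ i j, Arc B' i j → j < n + 1 →
      (i = 0 ∧ j = 1) ∨ (1 ≤ i ∧ Arc B (i - 1) (j - 1)) := by
    intro i j ha
    induction ha with
    | unit i =>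
      intro _
      rcases Nat.eq_zero_or_pos i with rfl | hi
      · exact .inl ⟨rfl, rfl⟩
      · exact .inr ⟨hi, .of_eq (by omega)⟩
    | @join i k j h1 h2 hij ih1 ih2 =>
      intro hj
      have := h2.lt
      rw [hmem] at hij
      push Not at hij
      have ih2 := ih2 hj
      rcases ih1 (by omega) with ⟨rfl, rfl⟩ | ⟨hi, h1'⟩
      · obtain ⟨-, h2'⟩ := ih2.resolve_left (by omega)
        have := h.clean _ h2' (by omega)
        omega
      · obtain ⟨-, h2'⟩ := ih2.resolve_left (by have := h1.lt; omega)
        exact .inr ⟨hi, .join h1' h2' (hij.2 hi (by omega))⟩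
  refine ⟨⟨by omega, ?_, ?_, ?_⟩, ?_⟩
  · intro i j hij
    rcases (hmem i j).1 hij with ⟨rfl, rfl⟩ | ⟨hi, hj, hij⟩
    · omega
    · have := h.diag _ _ hij
      omega
  · intro i j hij
    rcases (hmem i j).1 hij with ⟨rfl, rfl⟩ | ⟨hi, hj, hij⟩
    · exact ⟨1, .unit 0, .unit 1⟩
    · have := (h.split _ _ hij).embed hemb (h.diag _ _ hij).2.1
      rwa [Nat.sub_add_cancel hi, Nat.sub_add_cancel hj] at this
  · intro i j hij
    rcases (hmem i j).1 hij with ⟨rfl, rfl⟩ | ⟨hi, hj, hij⟩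
    · exact hfan
    · have := (h.outer _ _ hij).embed (by omega) hemb hfirst
      rwa [Nat.sub_add_cancel hi, Nat.sub_add_cancel hj] at this
  · intro j ha hj
    have := harc _ _ ha hj
    omega

/-- A family of left-clean sets with two chords at almost every vertex. -/
def zigzag (n : ℕ) : Finset (ℕ × ℕ) :=
  {(0, 2), (0, 3), (1, 4)} ∪ {2, 3} ×ˢ Finset.Ico 5 n

theorem card_zigzag {n : ℕ} (hn : 5 ≤ n) : (zigzag n).card = 2 * n - 7 := by
  rw [zigzag, Finset.card_union_of_disjoint, Finset.card_product]
  · simp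
    omega
  · simp [Finset.disjoint_left]

theorem leftClean_zigzag {n : ℕ} (hn : 5 ≤ n) : LeftClean n (zigzag n) := by
  have hmem : ∀ i j, (i, j) ∈ zigzag n ↔ (i = 0 ∧ j = 2) ∨ (i = 0 ∧ j = 3) ∨ (i = 1 ∧ j = 4) ∨
      ((i = 2 ∨ i = 3) ∧ 5 ≤ j ∧ j < n) := by
    intro i j
    simp [zigzag]
  have harc : ∀ i j, Arc (zigzag n) i j → j < n →
      j = i + 1 ∨ (i = 1 ∧ j = 3) ∨ (i = 2 ∧ j = 4) ∨ 4 ≤ i := by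
    intro i j ha
    induction ha with
    | unit i => simp
    | @join i k j h1 h2 hij ih1 ih2 =>
      intro hj
      have := h1.lt
      have := h2.lt
      have ih1 := ih1 (by omega)
      have ih2 := ih2 hj
      rw [hmem] at hij
      omega
  have h13 : Arc (zigzag n) 1 3 := .join (.unit 1) (.unit 2) (by rw [hmem]; omega)
  have h24 : Arc (zigzag n) 2 4 := .join (.unit 2) (.unit 3) (by rw [hmem]; omega)
  have hfull : ∀ i j, 4 ≤ i → i < j → Arc (zigzag n) i j := fun i j hi hij =>
    .fan_left hij fun k _ _ => by rw [hmem]; omega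
  have hzero : ∀ j, 4 ≤ j → j < n → Outer (zigzag n) 0 (n - 1) 0 j := fun j hj hjn =>
    .fan .root (by omega) (by omega) fun k _ _ => by rw [hmem]; omega
  have hone : ∀ j, 4 ≤ j → j < n → Outer (zigzag n) 0 (n - 1) 1 j := fun j hj hjn =>
    .left (hzero j hj hjn) (by rw [hmem]; omega) (.unit 0) (by omega)
  refine ⟨⟨hn, ?_, ?_, ?_⟩, ?_⟩
  · intro i j hij
    rw [hmem] at hij
    omega
  · intro i j hij
    rcases (hmem i j).1 hij with ⟨rfl, rfl⟩ | ⟨rfl, rfl⟩ | ⟨rfl, rfl⟩ | ⟨rfl | rfl, hj, hjn⟩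
    · exact ⟨1, .unit 0, .unit 1⟩
    · exact ⟨1, .unit 0, h13⟩
    · exact ⟨3, h13, .unit 3⟩
    · exact ⟨4, h24, hfull _ _ le_rfl (by omega)⟩
    · exact ⟨4, .unit 3, hfull _ _ le_rfl (by omega)⟩
  · intro i j hij
    have h04 := hzero 4 le_rfl (by omega)
    have n04 : (0, 4) ∉ zigzag n := by rw [hmem]; omega
    rcases (hmem i j).1 hij with ⟨rfl, rfl⟩ | ⟨rfl, rfl⟩ | ⟨rfl, rfl⟩ | ⟨rfl | rfl, hj, hjn⟩
    · exact .right h04 n04 h24 (by omega)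
    · exact .right h04 n04 (.unit 3) (by omega)
    · exact hone 4 le_rfl (by omega)
    · exact .left (hone j (by omega) hjn) (by rw [hmem]; omega) (.unit 1) (by omega)
    · exact .left (hone j (by omega) hjn) (by rw [hmem]; omega) h13 (by omega)
  · intro j ha hj
    have := harc _ _ ha hj
    omega

/-- Merging a chord set on `p` vertices and one on `q` vertices: they are placed on
`2, …, p + 1` and on `p + 7, …, p + q + 6`, and all chords between the two blocks are added,
together with a few chords at the remaining vertices. -/
def merge (p q : ℕ) (B₁ B₂ : Finset (ℕ × ℕ)) : Finset (ℕ × ℕ) :=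
  (shift 2 B₁ ∪ shift (p + 7) B₂) ∪
    ((Finset.Icc 2 (p + 1) ×ˢ Finset.Icc (p + 7) (p + q + 7) ∪ {0} ×ˢ Finset.Icc 2 (p + 1)) ∪
      {(0, p + 5), (p, p + 2), (p + 1, p + 3), (1, p + 2), (1, p + 4), (1, p + 6),
        (p + 5, p + 7), (p + 6, p + 8), (p + 6, p + q + 7)})

section Merge

variable {p q : ℕ} {B₁ B₂ : Finset (ℕ × ℕ)}

theorem mem_merge {i j : ℕ} : (i, j) ∈ merge p q B₁ B₂ ↔
    ((2 ≤ i ∧ 2 ≤ j ∧ (i - 2, j - 2) ∈ B₁) ∨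
      (p + 7 ≤ i ∧ p + 7 ≤ j ∧ (i - (p + 7), j - (p + 7)) ∈ B₂)) ∨
    (2 ≤ i ∧ i ≤ p + 1 ∧ p + 7 ≤ j ∧ j ≤ p + q + 7) ∨ (i = 0 ∧ 2 ≤ j ∧ j ≤ p + 1) ∨
    (i = 0 ∧ j = p + 5) ∨ (i = p ∧ j = p + 2) ∨ (i = p + 1 ∧ j = p + 3) ∨
    (i = 1 ∧ j = p + 2) ∨ (i = 1 ∧ j = p + 4) ∨ (i = 1 ∧ j = p + 6) ∨ (i = p + 5 ∧ j = p + 7) ∨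
    (i = p + 6 ∧ j = p + 8) ∨ (i = p + 6 ∧ j = p + q + 7) := by
  simp only [merge, Finset.mem_union, mem_shift, Finset.mem_product, Finset.mem_Icc,
    Finset.mem_insert, Finset.mem_singleton, Prod.mk.injEq, or_assoc, and_assoc]

theorem card_merge (h₁ : Healing p B₁) (h₂ : Healing q B₂) :
    (merge p q B₁ B₂).card = B₁.card + B₂.card + p * (q + 1) + p + 9 := by
  have hp := h₁.five_le
  have hq := h₂.five_le
  rw [merge, Finset.card_union_of_disjoint, Finset.card_union_of_disjoint,
    Finset.card_union_of_disjoint, Finset.card_union_of_disjoint, card_shift, card_shift,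
    Finset.card_product, Finset.card_product]
  · have : ({(0, p + 5), (p, p + 2), (p + 1, p + 3), (1, p + 2), (1, p + 4), (1, p + 6),
        (p + 5, p + 7), (p + 6, p + 8), (p + 6, p + q + 7)} : Finset (ℕ × ℕ)).card = 9 := by
      repeat rw [Finset.card_insert_of_notMem (by simp <;> omega)]
      simp
    rw [this]
    simp only [Nat.card_Icc, Finset.card_singleton]
    rw [show p + 1 + 1 - 2 = p by omega, show p + q + 7 + 1 - (p + 7) = q + 1 by omega]
    ring
  · rw [Finset.disjoint_left]
    rintro ⟨i, j⟩ h h'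
    simp only [Finset.mem_product, Finset.mem_Icc, Finset.mem_singleton] at h h'
    omega
  · rw [Finset.disjoint_left]
    rintro ⟨i, j⟩ h h'
    simp only [Finset.mem_union, Finset.mem_product, Finset.mem_Icc, Finset.mem_singleton,
      Finset.mem_insert, Prod.mk.injEq] at h h'
    omega
  · rw [Finset.disjoint_left]
    rintro ⟨i, j⟩ h h'
    rw [mem_shift] at h h'
    have := h₁.diag _ _ h.2.2
    omega
  · rw [Finset.disjoint_left]
    rintro ⟨i, j⟩ h h'
    simp only [Finset.mem_union, Finset.mem_product, Finset.mem_Icc, Finset.mem_singleton,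
      Finset.mem_insert, Prod.mk.injEq, mem_shift] at h h'
    rcases h with h | h
    · have := h₁.diag _ _ h.2.2
      omega
    · have := h₂.diag _ _ h.2.2
      omega

/-- Membership in `merge` for chords not lying in one of the two blocks. -/
theorem mem_merge_of_not_block (h₁ : Healing p B₁) (h₂ : Healing q B₂) {i j : ℕ}
    (hC₁ : ¬ (2 ≤ i ∧ j ≤ p + 1)) (hC₂ : ¬ (p + 7 ≤ i ∧ j ≤ p + q + 6)) :
    (i, j) ∈ merge p q B₁ B₂ ↔
    (2 ≤ i ∧ i ≤ p + 1 ∧ p + 7 ≤ j ∧ j ≤ p + q + 7) ∨ (i = 0 ∧ 2 ≤ j ∧ j ≤ p + 1) ∨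
    (i = 0 ∧ j = p + 5) ∨ (i = p ∧ j = p + 2) ∨ (i = p + 1 ∧ j = p + 3) ∨
    (i = 1 ∧ j = p + 2) ∨ (i = 1 ∧ j = p + 4) ∨ (i = 1 ∧ j = p + 6) ∨ (i = p + 5 ∧ j = p + 7) ∨
    (i = p + 6 ∧ j = p + 8) ∨ (i = p + 6 ∧ j = p + q + 7) := by
  rw [mem_merge, or_iff_right]
  have := h₁.five_le
  have := h₂.five_le
  rintro (⟨h, h', hB⟩ | ⟨h, h', hB⟩)
  · have := h₁.diag _ _ hB
    omega
  · have := h₂.diag _ _ hB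
    omega

theorem merge_arc (h₁ : RightClean p B₁) (h₂ : LeftClean q B₂) {i j : ℕ}
    (ha : Arc (merge p q B₁ B₂) i j) : j < p + q + 8 →
    (2 ≤ i ∧ j ≤ p + 1 ∧ Arc B₁ (i - 2) (j - 2)) ∨
    (p + 7 ≤ i ∧ j ≤ p + q + 6 ∧ Arc B₂ (i - (p + 7)) (j - (p + 7))) ∨
    j = i + 1 ∨ (i = 1 ∧ (j ≤ p + 1 ∨ j = p + 5)) ∨ (2 ≤ i ∧ i ≤ p + 1 ∧ p + 4 ≤ j ∧ j ≤ p + 6) ∨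
    (p + 2 ≤ i ∧ i ≤ p + 4) ∨ (p + 7 ≤ i ∧ j = p + q + 7) := by
  have hp := h₁.five_le
  have hq := h₂.five_le
  induction ha with
  | unit i => simp
  | @join i k j h1 h2 hij ih1 ih2 =>
    intro hj
    have hik := h1.lt
    have hkj := h2.lt
    have ih1 := ih1 (by omega)
    have ih2 := ih2 hj
    by_cases hC₁ : 2 ≤ i ∧ j ≤ p + 1
    · have e1 : Arc B₁ (i - 2) (k - 2) := by
        rcases ih1 with h | h | h | h
        · exact h.2.2
        · omega
        · exact .of_eq (by omega)
        · omega
      have e2 : Arc B₁ (k - 2) (j - 2) := by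
        rcases ih2 with h | h | h | h
        · exact h.2.2
        · omega
        · exact .of_eq (by omega)
        · omega
      exact .inl ⟨hC₁.1, hC₁.2, .join e1 e2 fun h =>
        hij (mem_merge.2 (.inl (.inl ⟨hC₁.1, by omega, h⟩)))⟩
    by_cases hC₂ : p + 7 ≤ i ∧ j ≤ p + q + 6
    · have e1 : Arc B₂ (i - (p + 7)) (k - (p + 7)) := by
        rcases ih1 with h | h | h | h
        · omega
        · exact h.2.2
        · exact .of_eq (by omega)
        · omega
      have e2 : Arc B₂ (k - (p + 7)) (j - (p + 7)) := by
        rcases ih2 with h | h | h | h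
        · omega
        · exact h.2.2
        · exact .of_eq (by omega)
        · omega
      exact .inr (.inl ⟨hC₂.1, hC₂.2, .join e1 e2 fun h =>
        hij (mem_merge.2 (.inl (.inr ⟨hC₂.1, by omega, h⟩)))⟩)
    right; right
    have c1 : 2 ≤ i → k = p + 1 → i + 1 = k := by
      intro hi hk
      rcases ih1 with h | h | h | h
      · have := h.2.2
        rw [show k - 2 = p - 1 by omega] at this
        have := h₁.clean _ this
        omega
      all_goals omega
    have c2 : k = p + 7 → j ≤ p + q + 6 → j = k + 1 := by
      intro hk hjq
      rcases ih2 with h | h | h | h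
      · omega
      · have := h.2.2
        rw [show k - (p + 7) = 0 by omega] at this
        have := h₂.clean _ this (by omega)
        omega
      all_goals omega
    rw [mem_merge_of_not_block h₁.toHealing h₂.toHealing hC₁ hC₂] at hij
    have ih1' : (2 ≤ i ∧ k ≤ p + 1) ∨ (p + 7 ≤ i ∧ k ≤ p + q + 6) ∨
      k = i + 1 ∨ (i = 1 ∧ (k ≤ p + 1 ∨ k = p + 5)) ∨
      (2 ≤ i ∧ i ≤ p + 1 ∧ p + 4 ≤ k ∧ k ≤ p + 6) ∨
      (p + 2 ≤ i ∧ i ≤ p + 4) ∨ (p + 7 ≤ i ∧ k = p + q + 7) :=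
      ih1.imp (fun h => ⟨h.1, h.2.1⟩) (Or.imp_left fun h => ⟨h.1, h.2.1⟩)
    have ih2' : (2 ≤ k ∧ j ≤ p + 1) ∨ (p + 7 ≤ k ∧ j ≤ p + q + 6) ∨
      j = k + 1 ∨ (k = 1 ∧ (j ≤ p + 1 ∨ j = p + 5)) ∨
      (2 ≤ k ∧ k ≤ p + 1 ∧ p + 4 ≤ j ∧ j ≤ p + 6) ∨
      (p + 2 ≤ k ∧ k ≤ p + 4) ∨ (p + 7 ≤ k ∧ j = p + q + 7) :=
      ih2.imp (fun h => ⟨h.1, h.2.1⟩) (Or.imp_left fun h => ⟨h.1, h.2.1⟩)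
    clear ih1 ih2
    simp only [not_or] at hij
    obtain ⟨x1, x2, x3, x4, x5, x6, x7, x8, x9, x10, x11⟩ := hij
    have hi : i = 0 ∨ i = 1 ∨ (2 ≤ i ∧ i ≤ p + 1) ∨ (p + 2 ≤ i ∧ i ≤ p + 4) ∨ i = p + 5 ∨
        i = p + 6 ∨ p + 7 ≤ i := by clear * -; omega
    rcases hi with rfl | rfl | hi | hi | rfl | rfl | hi
    · clear x1 x4 x5 x6 x7 x8 x9 x10 x11 c1 c2 hC₁ hC₂
      have hk : k = 1 := by clear ih2' x2 x3; omega
      omega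
    · clear x1 x2 x3 x4 x5 x9 x10 x11 c1 c2 hC₁ hC₂
      have hk : k ≤ p + 1 ∨ k = p + 5 := by clear ih2' x6 x7 x8; omega
      have hj' : j ≤ p + 2 ∨ (p + 4 ≤ j ∧ j ≤ p + 6) := by clear ih1' x6 x7 x8; omega
      clear ih1' ih2'
      omega
    · clear x2 x3 x6 x7 x8 x9 x10 x11 c2 hC₂
      have hj' : p + 2 ≤ j ∧ j ≤ p + 6 := by clear ih1' ih2'; omega
      have hj2 : j ≠ p + 2 := by
        rintro rfl
        have hk : k = p + 1 := by clear ih1' x1 x4 x5; omega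
        have := c1 hi.1 hk
        omega
      have hj3 : j ≠ p + 3 := by
        rintro rfl
        have hk : k = p + 2 := by clear ih1' x1 x4 x5; omega
        have hi' : i = p + 1 := by clear ih2' x1 x4 x5; omega
        omega
      clear ih1' ih2' x1 x4 x5 c1
      omega
    · clear * - hi
      omega
    · have hk : k = p + 6 := by clear * - ih1' hik; omega
      have hj' : j = p + 7 := by clear * - ih2' hk hkj; omega
      exact absurd ⟨rfl, hj'⟩ x9
    · have hk : k = p + 7 := by clear * - ih1' hik; omega
      clear * - hk c2 x10 x11 hj
      omega
    · clear * - hi hC₂ hj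
      omega

theorem leftClean_merge (h₁ : RightClean p B₁) (h₂ : LeftClean q B₂) :
    LeftClean (p + q + 8) (merge p q B₁ B₂) := by
  have hp := h₁.five_le
  have hq := h₂.five_le
  have hmem {i j : ℕ} := @mem_merge_of_not_block p q B₁ B₂ h₁.toHealing h₂.toHealing i j
  set M := merge p q B₁ B₂ with hM
  have hemb₁ : ∀ i j, (i, j) ∉ B₁ → j < p → (i + 2, j + 2) ∉ M := by
    intro i j hij hj h
    rcases mem_merge.1 h with (h | h) | h
    · exact hij (by simpa using h.2.2)
    · have := h₂.diag _ _ h.2.2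
      omega
    · omega
  have hemb₂ : ∀ i j, (i, j) ∉ B₂ → j < q → (i + (p + 7), j + (p + 7)) ∉ M := by
    intro i j hij hj h
    rcases mem_merge.1 h with (h | h) | h
    · have := h₁.diag _ _ h.2.2
      omega
    · exact hij (by simpa using h.2.2)
    · omega
  -- Arcs
  have a1 : ∀ i, 2 ≤ i → i ≤ p + 1 → Arc M 1 i := fun i hi hi' =>
    .fan_left (by omega) fun k _ _ => by rw [hmem (by omega) (by omega)]; omega
  have am : ∀ i, 2 ≤ i → i ≤ p + 2 → Arc M i (p + 4) := fun i hi hi' =>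
    .fan_right (by omega) fun k _ _ => by rw [hmem (by omega) (by omega)]; omega
  have ma : ∀ j, p + 4 < j → Arc M (p + 4) j := fun j hj =>
    .fan_left hj fun k _ _ => by rw [hmem (by omega) (by omega)]; omega
  have ab : ∀ j, p + 7 ≤ j → j ≤ p + q + 6 → Arc M j (p + q + 7) := fun j hj hj' =>
    .fan_right (by omega) fun k _ _ => by rw [hmem (by omega) (by omega)]; omega
  have bx : Arc M (p + 1) (p + 5) := .join (am _ (by omega) (by omega)) (.unit _)
    (by rw [hmem (by omega) (by omega)]; omega)
  have ax : Arc M 1 (p + 5) := .join (a1 _ (by omega) le_rfl) bx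
    (by rw [hmem (by omega) (by omega)]; omega)
  have yb : Arc M (p + 3) (p + q + 7) := .join (.unit _) (ma _ (by omega))
    (by rw [hmem (by omega) (by omega)]; omega)
  -- Outer sides
  have o1b : Outer M 0 (p + q + 7) 1 (p + q + 7) :=
    .left .root (by rw [hmem (by omega) (by omega)]; omega) (.unit 0) (by omega)
  have n1b : (1, p + q + 7) ∉ M := by rw [hmem (by omega) (by omega)]; omega
  have o1 : ∀ j, p + 7 ≤ j → j ≤ p + q + 7 → Outer M 0 (p + q + 7) 1 j := by
    intro j hj hj'
    rcases eq_or_lt_of_le hj' with rfl | hj'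
    · exact o1b
    · exact .right o1b n1b (ab j hj (by omega)) (by omega)
  have n1 : ∀ j, p + 7 ≤ j → (1, j) ∉ M := fun j hj => by
    rw [hmem (by omega) (by omega)]; omega
  have o1y : Outer M 0 (p + q + 7) 1 (p + 3) := .right o1b n1b yb (by omega)
  have n1y : (1, p + 3) ∉ M := by rw [hmem (by omega) (by omega)]; omega
  have oc₁ : Outer M 0 (p + q + 7) 2 (p - 1 + 2) := by
    rw [show p - 1 + 2 = p + 1 by omega]
    refine .right (j' := p + 2) (.right (j' := p + 3) (.left o1y n1y (.unit 1) (by omega)) ?_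
      (.unit _) (by omega)) ?_ (.unit _) (by omega) <;>
    · rw [hmem (by omega) (by omega)]; omega
  have ox : ∀ j, p + 7 ≤ j → j ≤ p + q + 7 → Outer M 0 (p + q + 7) (p + 5) j := fun j hj hj' =>
    .left (o1 j hj hj') (n1 j hj) ax (by omega)
  have ov : ∀ j, p + 8 ≤ j → j ≤ p + q + 7 → Outer M 0 (p + q + 7) (p + 6) j := fun j hj hj' =>
    .left (ox j (by omega) hj') (by rw [hmem (by omega) (by omega)]; omega) (.unit _) (by omega)
  have oc₂ : Outer M 0 (p + q + 7) (p + 7) (q - 1 + (p + 7)) :=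
    .left (ov _ (by omega) (by omega)) (by rw [hmem (by omega) (by omega)]; omega) (.unit _)
      (by omega)
  have o0a : Outer M 0 (p + q + 7) 0 (p + 7) :=
    .right .root (by rw [hmem (by omega) (by omega)]; omega) (ab _ le_rfl (by omega)) (by omega)
  have o0m : Outer M 0 (p + q + 7) 0 (p + 4) :=
    .right .root (by rw [hmem (by omega) (by omega)]; omega) (ma _ (by omega)) (by omega)
  refine ⟨⟨by omega, ?_, ?_, ?_⟩, ?_⟩
  · intro i j hij
    rcases mem_merge.1 hij with (h | h) | h
    · have := h₁.diag _ _ h.2.2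
      omega
    · have := h₂.diag _ _ h.2.2
      omega
    · omega
  · intro i j hij
    rcases mem_merge.1 hij with (⟨hi, hj, h⟩ | ⟨hi, hj, h⟩) | ⟨hi, hi', hj, hj'⟩ |
      ⟨rfl, hj, hj'⟩ | ⟨rfl, rfl⟩ | ⟨rfl, rfl⟩ | ⟨rfl, rfl⟩ | ⟨rfl, rfl⟩ | ⟨rfl, rfl⟩ |
      ⟨rfl, rfl⟩ | ⟨rfl, rfl⟩ | ⟨rfl, rfl⟩ | ⟨rfl, rfl⟩
    · have := (h₁.split _ _ h).embed hemb₁ (h₁.diag _ _ h).2.1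
      rwa [Nat.sub_add_cancel hi, Nat.sub_add_cancel hj] at this
    · have := (h₂.split _ _ h).embed hemb₂ (h₂.diag _ _ h).2.1
      rwa [Nat.sub_add_cancel hi, Nat.sub_add_cancel hj] at this
    · exact ⟨p + 4, am i hi (by omega), ma j (by omega)⟩
    · exact ⟨1, .unit 0, a1 j hj hj'⟩
    · exact ⟨1, .unit 0, ax⟩
    · exact ⟨i + 1, .unit _, .unit _⟩
    · exact ⟨p + 2, .unit _, .unit _⟩
    · exact ⟨p + 1, a1 _ (by omega) le_rfl, .unit _⟩
    · exact ⟨p + 1, a1 _ (by omega) le_rfl, am _ (by omega) (by omega)⟩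
    · exact ⟨p + 5, ax, .unit _⟩
    · exact ⟨p + 6, .unit _, .unit _⟩
    · exact ⟨p + 7, .unit _, .unit _⟩
    · exact ⟨p + 7, .unit _, ab _ le_rfl (by omega)⟩
  · rw [show p + q + 8 - 1 = p + q + 7 by omega]
    intro i j hij
    rcases mem_merge.1 hij with (⟨hi, hj, h⟩ | ⟨hi, hj, h⟩) | ⟨hi, hi', hj, hj'⟩ |
      ⟨rfl, hj, hj'⟩ | ⟨rfl, rfl⟩ | ⟨rfl, rfl⟩ | ⟨rfl, rfl⟩ | ⟨rfl, rfl⟩ | ⟨rfl, rfl⟩ |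
      ⟨rfl, rfl⟩ | ⟨rfl, rfl⟩ | ⟨rfl, rfl⟩ | ⟨rfl, rfl⟩
    · have := (h₁.outer _ _ h).embed (by omega) hemb₁ oc₁
      rwa [Nat.sub_add_cancel hi, Nat.sub_add_cancel hj] at this
    · have := (h₂.outer _ _ h).embed (by omega) hemb₂ oc₂
      rwa [Nat.sub_add_cancel hi, Nat.sub_add_cancel hj] at this
    · exact .left (o1 j hj hj') (n1 j hj) (a1 i hi hi') (by omega)
    · exact .right o0m (by rw [hmem (by omega) (by omega)]; omega) (am j hj (by omega)) (by omega)
    · refine .right (j' := p + 6) (.right o0a ?_ (.unit _) (by omega)) ?_ (.unit _) (by omega) <;>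
      · rw [hmem (by omega) (by omega)]; omega
    · exact .right (.left o1y n1y (a1 i (by omega) (by omega)) (by omega))
        (by rw [hmem (by omega) (by omega)]; omega) (.unit _) (by omega)
    · exact .left o1y n1y (a1 _ (by omega) le_rfl) (by omega)
    · exact .right o1y n1y (.unit _) (by omega)
    · exact .right (o1 _ le_rfl (by omega)) (n1 _ le_rfl) (ma _ (by omega)) (by omega)
    · exact .right (o1 _ le_rfl (by omega)) (n1 _ le_rfl) (.unit _) (by omega)
    · exact ox _ le_rfl (by omega)
    · exact ov _ le_rfl (by omega)
    · exact ov _ (by omega) le_rfl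
  · intro j ha hj
    have := merge_arc h₁ h₂ ha hj
    omega

end Merge

/-! ### The attainable sizes -/

/-- The polygon on `n` vertices has a left-clean set with `n - 2 + x` chords. -/
def Attains (n x : ℕ) : Prop := ∃ B, LeftClean n B ∧ B.card + 2 = n + x

namespace Attains

theorem mono {n m x : ℕ} (h : Attains n x) (hnm : n ≤ m) : Attains m x := by
  induction m, hnm using Nat.le_induction with
  | base => exact h
  | succ m _ ih =>
    obtain ⟨B, hB, hc⟩ := ih
    refine ⟨_, hB.ear, ?_⟩
    rw [Finset.card_insert_of_notMem (by simp [mem_shift]), card_shift]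
    omega

theorem of_add_five_le {n x : ℕ} (h : x + 5 ≤ n) : Attains n x :=
  mono ⟨_, leftClean_zigzag (n := x + 5) (by omega), by rw [card_zigzag] <;> omega⟩ h

theorem merge {p q x₁ x₂ y : ℕ} (h₁ : Attains p x₁) (h₂ : Attains q x₂)
    (hy : y + 1 = x₁ + x₂ + p * (q + 2)) : Attains (p + q + 8) y := by
  obtain ⟨B₁, hB₁, hc₁⟩ := h₁
  obtain ⟨B₂, hB₂, hc₂⟩ := h₂
  have := card_mirror (n := p) (B := B₁) fun i j hij => by have := hB₁.diag i j hij; omega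
  refine ⟨_, leftClean_merge hB₁.mirror hB₂, ?_⟩
  rw [card_merge hB₁.mirror.toHealing hB₂.toHealing]
  linarith

theorem of_four_mul_le {n x : ℕ} (hn : 1000 ≤ n) (h : 4 * (x + 1) ≤ (n - 8) ^ 2) :
    Attains n x := by
  obtain hx | hx := lt_or_ge (x + 1) 900
  · exact of_add_five_le (by omega)
  obtain ⟨s, hs, hs'⟩ : ∃ s, s * s ≤ x + 1 ∧ x + 1 < (s + 1) * (s + 1) :=
    ⟨_, Nat.sqrt_le _, Nat.lt_succ_sqrt _⟩
  have hs30 : 30 ≤ s := by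
    by_contra! hlt
    have : (s + 1) * (s + 1) ≤ 30 * 30 := Nat.mul_le_mul (by omega) (by omega)
    omega
  obtain ⟨p, rfl⟩ : ∃ p, s = p + 4 := ⟨s - 4, by omega⟩
  have hp : 0 < p := by omega
  have hdiv := Nat.div_add_mod (x + 1) p
  have hr := Nat.mod_lt (x + 1) hp
  have hk : p + 8 ≤ (x + 1) / p := (Nat.le_div_iff_mul_le hp).2 (by nlinarith)
  have hk' : (x + 1) / p < p + 11 := (Nat.div_lt_iff_lt_mul hp).2 (by nlinarith)
  have hn' : 2 * (p + 4) ≤ n - 8 := by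
    refine (Nat.pow_le_pow_iff_left two_ne_zero).1 ?_
    nlinarith
  obtain ⟨q, hq⟩ : ∃ q, (x + 1) / p = q + 2 := ⟨(x + 1) / p - 2, by omega⟩
  rw [hq] at hdiv hk hk'
  exact (merge (of_add_five_le (x := 0) (n := p) (by omega))
    (of_add_five_le (x := (x + 1) % p) (n := q) (by omega)) (by omega)).mono (by omega)

theorem of_le {n : ℕ} (hn : 5 ≤ n) {x : ℕ}
    (hx : (x : ℝ) ≤ max 0 ((n : ℝ) ^ 2 / 2 - 1000 * n * Real.log n)) : Attains n x := by
  induction n using Nat.strong_induction_on generalizing x with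
  | _ n ih =>
  rcases Nat.eq_zero_or_pos x with rfl | hpos
  · exact of_add_five_le (by omega)
  have hpos' : (1 : ℝ) ≤ x := by exact_mod_cast hpos
  replace hx : (x : ℝ) ≤ (n : ℝ) ^ 2 / 2 - 1000 * n * Real.log n := by
    rcases le_max_iff.1 hx with h | h
    · linarith
    · exact h
  have hn5 : (5 : ℝ) ≤ n := by exact_mod_cast hn
  have hlog : 1 ≤ Real.log n := by
    rw [Real.le_log_iff_exp_le (by linarith)]
    linarith [Real.exp_one_lt_d9]
  have hn2 : 2000 ≤ n := by
    have : (2000 : ℝ) ≤ n := by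
      by_contra! hlt
      nlinarith
    exact_mod_cast this
  obtain hsmall | hbig := le_or_gt (4 * (x + 1)) ((n - 8) ^ 2)
  · exact of_four_mul_le (by omega) hsmall
  obtain ⟨p, q, hpq, hp4, hp, hq, hq4⟩ :
      ∃ p q, n = p + q + 8 ∧ 4 * p ≤ n ∧ 5 ≤ p ∧ 5 ≤ q ∧ 5 * q ≤ 4 * n :=
    ⟨n / 4, n - 8 - n / 4, by omega, by omega, by omega, by omega, by omega⟩
  have hle : p * (q + 2) ≤ x + 1 := by
    obtain ⟨d, hd⟩ : ∃ d, n - 8 = d := ⟨_, rfl⟩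
    rw [hd] at hbig
    have hd' : p + q = d := by omega
    have h1 : 3 * p ≤ q + 8 := by omega
    have h2 : 1000 ≤ q := by omega
    subst hd'
    nlinarith
  obtain ⟨z, hz⟩ : ∃ z, x + 1 = z + p * (q + 2) := ⟨x + 1 - p * (q + 2), by omega⟩
  have hnR : (n : ℝ) = p + q + 8 := by exact_mod_cast hpq
  have hzR : (x : ℝ) + 1 = z + p * (q + 2) := by exact_mod_cast hz
  have hp5 : (5 : ℝ) ≤ p := by exact_mod_cast hp
  have hq5 : (5 : ℝ) ≤ q := by exact_mod_cast hq
  have hlogle : ∀ m : ℕ, 5 ≤ m → 5 * m ≤ 4 * n → Real.log m ≤ Real.log n - 1 / 5 := by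
    intro m hm hmn
    have hm5 : (5 : ℝ) ≤ m := by exact_mod_cast hm
    have hmnR : 5 * (m : ℝ) ≤ 4 * n := by exact_mod_cast hmn
    have h1 : Real.log ((m : ℝ) / n) ≤ m / n - 1 := Real.log_le_sub_one_of_pos (by positivity)
    rw [Real.log_div (by positivity) (by positivity)] at h1
    have h2 : (m : ℝ) / n ≤ 4 / 5 := by
      rw [div_le_iff₀ (by positivity)]
      linarith
    linarith
  have hlp := mul_le_mul_of_nonneg_left (hlogle p hp (by omega)) (by linarith : (0 : ℝ) ≤ p)
  have hlq := mul_le_mul_of_nonneg_left (hlogle q hq hq4) (by linarith : (0 : ℝ) ≤ q)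
  have hsum : (z : ℝ) + 1 ≤ ((p : ℝ) ^ 2 / 2 - 1000 * p * Real.log p) +
      ((q : ℝ) ^ 2 / 2 - 1000 * q * Real.log q) := by
    rw [hnR] at hx hlog hlp hlq
    nlinarith
  set x₁ := min z ⌊(p : ℝ) ^ 2 / 2 - 1000 * p * Real.log p⌋₊ with hx₁
  have hx₁' : (x₁ : ℝ) ≤ max 0 ((p : ℝ) ^ 2 / 2 - 1000 * p * Real.log p) := by
    rw [← Nat.le_floor_iff (le_max_left _ _)]
    exact (min_le_right _ _).trans (Nat.floor_le_floor (le_max_right _ _))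
  have hx₂' : ((z - x₁ : ℕ) : ℝ) ≤ max 0 ((q : ℝ) ^ 2 / 2 - 1000 * q * Real.log q) := by
    rcases le_total z ⌊(p : ℝ) ^ 2 / 2 - 1000 * p * Real.log p⌋₊ with h | h
    · rw [hx₁, min_eq_left h]
      simp
    · refine le_max_of_le_right ?_
      rw [Nat.cast_sub (min_le_left _ _), min_eq_right h]
      linarith [Nat.lt_floor_add_one ((p : ℝ) ^ 2 / 2 - 1000 * p * Real.log p)]
  rw [hpq]
  exact merge (ih p (by omega) hp hx₁') (ih q (by omega) hq hx₂')
    (by have : x₁ ≤ z := min_le_left _ _; omega)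

end Attains

/-! ### Triangulations of the interval model -/

/-- `S` is a triangulation, avoiding `B`, of the polygon on `i, …, j` (possibly together with
the chord `(i, j)`). -/
structure Dissects (B S : Finset (ℕ × ℕ)) (i j : ℕ) : Prop where
  mem : ∀ c d, (c, d) ∈ S → i ≤ c ∧ c + 2 ≤ d ∧ d ≤ j ∧ (c, d) ∉ B
  noncrossing : ∀ a b c d, (a, b) ∈ S → (c, d) ∈ S → ¬ (a < c ∧ c < b ∧ b < d)
  maximal : ∀ c d, i ≤ c → c + 2 ≤ d → d ≤ j → ¬ (c = i ∧ d = j) → (c, d) ∉ S →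
    ∃ a b, (a, b) ∈ S ∧ (a < c ∧ c < b ∧ b < d ∨ c < a ∧ a < d ∧ d < b)

theorem Dissects.union {S₁ S₂ : Finset (ℕ × ℕ)} {i k j : ℕ}
    (h₁ : Dissects B S₁ i k) (ht₁ : i + 2 ≤ k → (i, k) ∈ S₁) (hik : i < k)
    (h₂ : Dissects B S₂ k j) (ht₂ : k + 2 ≤ j → (k, j) ∈ S₂) (hkj : k < j) :
    Dissects B (S₁ ∪ S₂) i j := by
  refine ⟨?_, ?_, ?_⟩
  · intro c d h
    rcases Finset.mem_union.1 h with h | h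
    · have := h₁.mem _ _ h
      exact ⟨this.1, this.2.1, by omega, this.2.2.2⟩
    · have := h₂.mem _ _ h
      exact ⟨by omega, this.2.1, this.2.2.1, this.2.2.2⟩
  · intro a b c d h h'
    rcases Finset.mem_union.1 h with h | h <;> rcases Finset.mem_union.1 h' with h' | h'
    · exact h₁.noncrossing _ _ _ _ h h'
    · have := h₁.mem _ _ h
      have := h₂.mem _ _ h'
      omega
    · have := h₂.mem _ _ h
      have := h₁.mem _ _ h'
      omega
    · exact h₂.noncrossing _ _ _ _ h h'
  · intro c d hc hcd hd hne hS
    rw [Finset.mem_union, not_or] at hS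
    rcases le_or_gt d k with hdk | hdk
    · obtain ⟨a, b, h, h'⟩ := h₁.maximal c d hc hcd hdk
        (by rintro ⟨rfl, rfl⟩; exact hS.1 (ht₁ hcd)) hS.1
      exact ⟨a, b, Finset.mem_union_left _ h, h'⟩
    rcases le_or_gt k c with hkc | hkc
    · obtain ⟨a, b, h, h'⟩ := h₂.maximal c d hkc hcd hd
        (by rintro ⟨rfl, rfl⟩; exact hS.2 (ht₂ hcd)) hS.2
      exact ⟨a, b, Finset.mem_union_right _ h, h'⟩
    rcases eq_or_lt_of_le hc with rfl | hic
    · exact ⟨k, j, Finset.mem_union_right _ (ht₂ (by omega)), .inr (by omega)⟩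
    · exact ⟨i, k, Finset.mem_union_left _ (ht₁ (by omega)), .inl (by omega)⟩

theorem Dissects.insert {S : Finset (ℕ × ℕ)} {i j : ℕ} (h : Dissects B S i j) (hij : i + 2 ≤ j)
    (hB : (i, j) ∉ B) : Dissects B (insert (i, j) S) i j := by
  refine ⟨?_, ?_, ?_⟩
  · intro c d hcd
    rcases Finset.mem_insert.1 hcd with hcd | hcd
    · obtain ⟨rfl, rfl⟩ := Prod.mk.inj hcd
      exact ⟨le_rfl, hij, le_rfl, hB⟩
    · exact h.mem _ _ hcd
  · intro a b c d hab hcd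
    rw [Finset.mem_insert, Prod.mk.injEq] at hab hcd
    rcases hab with hab | hab <;> rcases hcd with hcd | hcd
    · omega
    · have := h.mem _ _ hcd
      omega
    · have := h.mem _ _ hab
      omega
    · exact h.noncrossing _ _ _ _ hab hcd
  · intro c d hc hcd hd hne hS
    obtain ⟨a, b, hab, h'⟩ :=
      h.maximal c d hc hcd hd hne fun h' => hS (Finset.mem_insert_of_mem h')
    exact ⟨a, b, Finset.mem_insert_of_mem hab, h'⟩

theorem Arc.exists_dissects {i j : ℕ} (h : Arc B i j) :
    ∃ S, Dissects B S i j ∧ (i + 2 ≤ j → (i, j) ∈ S) := by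
  induction h with
  | unit i =>
    refine ⟨∅, ⟨by simp, by simp, ?_⟩, ?_⟩
    · intros
      omega
    · omega
  | @join i k j h1 h2 hB ih1 ih2 =>
    obtain ⟨S₁, hS₁, ht₁⟩ := ih1
    obtain ⟨S₂, hS₂, ht₂⟩ := ih2
    have := h1.lt
    have := h2.lt
    exact ⟨_, (hS₁.union ht₁ h1.lt hS₂ ht₂ h2.lt).insert (by omega) hB,
      fun _ => Finset.mem_insert_self _ _⟩

theorem Split.exists_dissects {i j : ℕ} (h : Split B i j) :
    ∃ S, Dissects B S i j ∧ (i, j) ∉ S := by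
  obtain ⟨k, h1, h2⟩ := h
  obtain ⟨S₁, hS₁, ht₁⟩ := h1.exists_dissects
  obtain ⟨S₂, hS₂, ht₂⟩ := h2.exists_dissects
  refine ⟨_, hS₁.union ht₁ h1.lt hS₂ ht₂ h2.lt, fun h => ?_⟩
  have := h1.lt
  have := h2.lt
  rcases Finset.mem_union.1 h with h | h
  · have := hS₁.mem _ _ h
    omega
  · have := hS₂.mem _ _ h
    omega

/-- In a maximal noncrossing family `P`, every `(i, j)` not crossed by `P` is a side of a
triangle on its inner side. -/
theorem exists_apex {n : ℕ} {P : ℕ → ℕ → Prop}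
    (hnc : ∀ a b c d, P a b → P c d → a < c → c < b → b < d → d < n → False)
    (hmax : ∀ i j, i + 2 ≤ j → j < n → ¬ (i = 0 ∧ j = n - 1) → ¬ P i j → ∃ c d, d < n ∧ P c d ∧
      (i < c ∧ c < j ∧ j < d ∨ c < i ∧ i < d ∧ d < j))
    {i j : ℕ} (hij : i + 2 ≤ j) (hj : j < n)
    (hfree : ∀ c d, d < n → P c d → ¬ (i < c ∧ c < j ∧ j < d ∨ c < i ∧ i < d ∧ d < j)) :
    ∃ k, i < k ∧ k < j ∧ (k = i + 1 ∨ P i k) ∧ (j = k + 1 ∨ P k j) := by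
  classical
  let s := (Finset.Ioo i j).filter fun k => k = i + 1 ∨ P i k
  have hs : ∀ k, k ∈ s ↔ (i < k ∧ k < j) ∧ (k = i + 1 ∨ P i k) := by simp [s]
  obtain ⟨k, hks, hkmax⟩ := s.exists_max_image id ⟨i + 1, (hs _).2 ⟨by omega, .inl rfl⟩⟩
  obtain ⟨⟨hik, hkj⟩, hk⟩ := (hs k).1 hks
  refine ⟨k, hik, hkj, hk, ?_⟩
  by_contra! hne
  obtain ⟨c, d, hd, hcd, h⟩ := hmax k j (by omega) hj (by omega) hne.2
  have hf := hfree c d hd hcd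
  obtain ⟨h1, h2, h3⟩ : c < k ∧ k < d ∧ d < j := by omega
  have hic : i ≤ c := by omega
  rcases eq_or_lt_of_le hic with rfl | hic
  · have := hkmax d ((hs d).2 ⟨by omega, .inr hcd⟩)
    simp only [id] at this
    omega
  · rcases hk with hk | hk
    · omega
    · exact hnc _ _ _ _ hk hcd hic h1 h2 hd

theorem split_of_maximal {n : ℕ} (hn : 3 ≤ n) {P : ℕ → ℕ → Prop}
    (hnc : ∀ a b c d, P a b → P c d → a < c → c < b → b < d → d < n → False)
    (hmax : ∀ i j, i + 2 ≤ j → j < n → ¬ (i = 0 ∧ j = n - 1) → ¬ P i j → ∃ c d, d < n ∧ P c d ∧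
      (i < c ∧ c < j ∧ j < d ∨ c < i ∧ i < d ∧ d < j))
    (hB : ∀ i j, P i j → (i, j) ∉ B) : Split B 0 (n - 1) := by
  have harc : ∀ d i j, j = i + d → i < j → j < n → (j = i + 1 ∨ P i j) → Arc B i j := by
    intro d
    induction d using Nat.strong_induction_on with
    | _ d ih =>
    rintro i j hd hij hj h
    by_cases hij' : j = i + 1
    · exact .of_eq hij'
    have hP := h.resolve_left hij'
    obtain ⟨k, hik, hkj, h1, h2⟩ := exists_apex hnc hmax (i := i) (j := j) (by omega) hj (by
      rintro c d hd hcd (⟨h1, h2, h3⟩ | ⟨h1, h2, h3⟩)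
      · exact hnc _ _ _ _ hP hcd h1 h2 h3 hd
      · exact hnc _ _ _ _ hcd hP h1 h2 h3 hj)
    exact .join (ih (k - i) (by omega) i k (by omega) hik (by omega) h1)
      (ih (j - k) (by omega) k j (by omega) hkj hj h2) (hB _ _ hP)
  obtain ⟨k, hik, hkj, h1, h2⟩ := exists_apex hnc hmax (i := 0) (j := n - 1) (by omega) (by omega)
    (by omega)
  exact ⟨k, harc k 0 k (by omega) hik (by omega) h1,
    harc (n - 1 - k) k _ (by omega) hkj (by omega) h2⟩

/-! ### Back to the convex polygon -/

theorem val_natCast_sub {n a c : ℕ} (ha : a < n) (hc : c < n) :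
    ((c : ZMod n) - (a : ZMod n)).val = if a ≤ c then c - a else n + c - a := by
  split_ifs with h
  · rw [← Nat.cast_sub h, ZMod.val_natCast_of_lt (by omega)]
  · rw [show (c : ZMod n) - (a : ZMod n) = ((n + c - a : ℕ) : ZMod n) by
      rw [Nat.cast_sub (by omega)]; simp, ZMod.val_natCast_of_lt (by omega)]

theorem natCast_inj {n a b : ℕ} (ha : a < n) (hb : b < n) :
    (a : ZMod n) = (b : ZMod n) ↔ a = b := by
  rw [ZMod.natCast_eq_natCast_iff', Nat.mod_eq_of_lt ha, Nat.mod_eq_of_lt hb]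

theorem exists_natCast_eq {n : ℕ} (hn : 0 < n) (c : ZMod n) : ∃ a < n, (a : ZMod n) = c := by
  have : NeZero n := ⟨hn.ne'⟩
  exact ⟨c.val, c.val_lt, by simp⟩

/-- The edge of the `n`-gon spanned by a pair of natural numbers. -/
def chord (n : ℕ) (e : ℕ × ℕ) : Sym2 (ZMod n) := s((e.1 : ZMod n), (e.2 : ZMod n))

theorem chord_inj {n a b c d : ℕ} (hab : a < b) (hb : b < n) (hcd : c < d) (hd : d < n)
    (h : chord n (a, b) = chord n (c, d)) : a = c ∧ b = d := by
  simp only [chord, Sym2.eq_iff] at h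
  rw [natCast_inj (by omega) (by omega), natCast_inj (by omega) (by omega),
    natCast_inj (by omega) (by omega), natCast_inj (by omega) (by omega)] at h
  omega

theorem cross_chord_iff {n a b c d : ℕ} (hab : a < b) (hb : b < n) (hcd : c < d) (hd : d < n) :
    Cross n (chord n (a, b)) (chord n (c, d)) ↔
      (a < c ∧ c < b ∧ b < d) ∨ (c < a ∧ a < d ∧ d < b) := by
  have ha : a < n := by omega
  have hc : c < n := by omega
  constructor
  · rintro ⟨a', b', c', d', h1, h2, h⟩
    simp only [chord, Sym2.eq_iff] at h1 h2
    rcases h1 with ⟨rfl, rfl⟩ | ⟨rfl, rfl⟩ <;> rcases h2 with ⟨rfl, rfl⟩ | ⟨rfl, rfl⟩ <;>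
    · simp only [val_natCast_sub, ha, hb, hc, hd] at h
      split_ifs at h <;> omega
  · rintro (h | h)
    · refine ⟨a, b, c, d, rfl, rfl, ?_⟩
      simp only [val_natCast_sub, ha, hb, hc, hd]
      split_ifs <;> omega
    · refine ⟨a, b, d, c, rfl, Sym2.eq_swap, ?_⟩
      simp only [val_natCast_sub, ha, hb, hc, hd]
      split_ifs <;> omega

theorem isDiagonal_chord_iff {n i j : ℕ} (hij : i < j) (hj : j < n) :
    IsDiagonal n (chord n (i, j)) ↔ i + 2 ≤ j ∧ ¬ (i = 0 ∧ j = n - 1) := by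
  have hi : i < n := by omega
  constructor
  · rintro ⟨a, b, h, -, ⟨c, hc⟩, ⟨d, hd⟩⟩
    obtain ⟨c, hcn, rfl⟩ := exists_natCast_eq (by omega) c
    obtain ⟨d, hdn, rfl⟩ := exists_natCast_eq (by omega) d
    simp only [chord, Sym2.eq_iff] at h
    rcases h with ⟨rfl, rfl⟩ | ⟨rfl, rfl⟩ <;>
    · simp only [Btw, val_natCast_sub, hi, hj, hcn, hdn] at hc hd
      split_ifs at hc hd <;> omega
  · intro h
    have hi' : i + 1 < n := by omega
    refine ⟨i, j, rfl, by rw [Ne, natCast_inj hi hj]; omega, ⟨(i + 1 : ℕ), ?_⟩, ?_⟩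
    · simp only [Btw, val_natCast_sub, hi, hj, hi']
      split_ifs <;> omega
    · by_cases hj' : j + 1 < n
      · refine ⟨(j + 1 : ℕ), ?_⟩
        simp only [Btw, val_natCast_sub, hi, hj, hj']
        split_ifs <;> omega
      · have h0 : 0 < n := by omega
        refine ⟨(0 : ℕ), ?_⟩
        simp only [Btw, val_natCast_sub, hi, hj, h0]
        split_ifs <;> omega

theorem IsDiagonal.exists_chord {n : ℕ} (hn : 0 < n) {e : Sym2 (ZMod n)} (h : IsDiagonal n e) :
    ∃ i j, i < j ∧ j < n ∧ e = chord n (i, j) := by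
  obtain ⟨a, b, rfl, hab, -⟩ := h
  obtain ⟨a, ha, rfl⟩ := exists_natCast_eq hn a
  obtain ⟨b, hb, rfl⟩ := exists_natCast_eq hn b
  rw [Ne, natCast_inj ha hb] at hab
  rcases lt_or_gt_of_ne hab with h | h
  · exact ⟨a, b, h, hb, rfl⟩
  · exact ⟨b, a, h, ha, Sym2.eq_swap⟩

theorem IsTriangulation.split {n : ℕ} (hn : 3 ≤ n) {T : Finset (Sym2 (ZMod n))}
    (hT : IsTriangulation n T) (hB : ∀ e ∈ B, chord n e ∉ T) : Split B 0 (n - 1) := by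
  refine split_of_maximal hn (P := fun i j => i < j ∧ j < n ∧ chord n (i, j) ∈ T) ?_ ?_ ?_
  · rintro a b c d ⟨hab, hb, h⟩ ⟨hcd, hd, h'⟩ h1 h2 h3 -
    exact hT.2.1 _ h _ h' ((cross_chord_iff hab hb hcd hd).2 (.inl ⟨h1, h2, h3⟩))
  · intro i j hij hj hroot hP
    have hij' : i < j := by omega
    obtain ⟨f, hf, hcross⟩ := hT.2.2 (chord n (i, j))
      ((isDiagonal_chord_iff hij' hj).2 ⟨hij, hroot⟩) fun h => hP ⟨hij', hj, h⟩
    obtain ⟨c, d, hcd, hd, rfl⟩ := (hT.1 f hf).exists_chord (by omega)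
    exact ⟨c, d, hd, ⟨hcd, hd, hf⟩, (cross_chord_iff hij' hj hcd hd).1 hcross⟩
  · rintro i j ⟨-, -, h⟩ h'
    exact hB _ h' h

theorem Dissects.isTriangulation {n : ℕ} (hn : 0 < n) {S : Finset (ℕ × ℕ)}
    (hS : Dissects B S 0 (n - 1)) (hroot : (0, n - 1) ∉ S) :
    IsTriangulation n (S.image (chord n)) := by
  have hmem : ∀ c d, (c, d) ∈ S → c < d ∧ d < n := fun c d h => by
    have := hS.mem _ _ h
    omega
  refine ⟨?_, ?_, ?_⟩
  · intro e he
    obtain ⟨⟨c, d⟩, h, rfl⟩ := Finset.mem_image.1 he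
    rw [isDiagonal_chord_iff (hmem _ _ h).1 (hmem _ _ h).2]
    refine ⟨(hS.mem _ _ h).2.1, ?_⟩
    rintro ⟨rfl, rfl⟩
    exact hroot h
  · intro e he f hf
    obtain ⟨⟨a, b⟩, h, rfl⟩ := Finset.mem_image.1 he
    obtain ⟨⟨c, d⟩, h', rfl⟩ := Finset.mem_image.1 hf
    rw [cross_chord_iff (hmem _ _ h).1 (hmem _ _ h).2 (hmem _ _ h').1 (hmem _ _ h').2, not_or]
    exact ⟨hS.noncrossing _ _ _ _ h h', hS.noncrossing _ _ _ _ h' h⟩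
  · intro e he heS
    obtain ⟨c, d, hcd, hd, rfl⟩ := he.exists_chord hn
    rw [isDiagonal_chord_iff hcd hd] at he
    obtain ⟨a, b, h, h'⟩ := hS.maximal c d (Nat.zero_le _) he.1 (by omega) he.2
      fun h => heS (Finset.mem_image_of_mem _ h)
    refine ⟨_, Finset.mem_image_of_mem _ h, ?_⟩
    rw [cross_chord_iff hcd hd (hmem _ _ h).1 (hmem _ _ h).2]
    exact h'.symm

theorem Healing.injOn_chord {n : ℕ} (h : Healing n B) : Set.InjOn (chord n) B := by
  rintro ⟨a, b⟩ hab ⟨c, d⟩ hcd heq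
  have h1 := h.diag _ _ hab
  have h2 := h.diag _ _ hcd
  obtain ⟨rfl, rfl⟩ := chord_inj (by omega) (by omega) (by omega) (by omega) heq
  rfl

theorem LeftClean.isSaturatedBlocker {n : ℕ} (h : LeftClean n B) :
    IsSaturatedBlocker n (B.image (chord n)) := by
  have hn := h.five_le
  refine ⟨⟨?_, ?_⟩, ?_⟩
  · intro e he
    obtain ⟨⟨i, j⟩, hij, rfl⟩ := Finset.mem_image.1 he
    have := h.diag _ _ hij
    exact ⟨i, j, rfl, by rw [Ne, natCast_inj] <;> omega⟩
  · intro T hT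
    by_contra hne
    refine h.not_split (hT.split (by omega) fun e he heT => hne ⟨chord n e, ?_⟩)
    exact Finset.mem_inter.2 ⟨Finset.mem_image_of_mem _ he, heT⟩
  · rintro e he ⟨-, hblock⟩
    obtain ⟨⟨i, j⟩, hij, rfl⟩ := Finset.mem_image.1 he
    obtain ⟨S, hS, hroot⟩ := (h.split_erase hij).exists_dissects
    obtain ⟨f, hf⟩ := hblock _ (hS.isTriangulation (by omega) hroot)
    obtain ⟨hfB, hfS⟩ := Finset.mem_inter.1 hf
    obtain ⟨hne, hfB⟩ := Finset.mem_erase.1 hfB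
    obtain ⟨⟨a, b⟩, hab, rfl⟩ := Finset.mem_image.1 hfB
    obtain ⟨⟨c, d⟩, hcd, heq⟩ := Finset.mem_image.1 hfS
    have h1 := h.diag _ _ hab
    have h2 := hS.mem _ _ hcd
    obtain ⟨rfl, rfl⟩ := chord_inj (by omega) (by omega) (by omega) (by omega) heq
    exact h2.2.2.2 (Finset.mem_erase.2 ⟨fun h' => hne (h' ▸ rfl), hab⟩)

end ConvexBlocker

open ConvexBlocker in
/-- There exist a real constant `C > 0` and an integer `n₀` such that for every
integer `n > n₀` and every integer `t` with `n - 2 ≤ t ≤ n²/2 - C·n·log n`, there exists a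
saturated blocker of the convex `n`-gon with exactly `t` edges. -/
theorem saturation_spectrum :
    ∃ C : ℝ, 0 < C ∧ ∃ n₀ : ℕ, ∀ n : ℕ, n₀ < n → ∀ t : ℕ,
      n - 2 ≤ t → (t : ℝ) ≤ (n : ℝ) ^ 2 / 2 - C * n * Real.log n →
      ∃ B : Finset (Sym2 (ZMod n)), IsSaturatedBlocker n B ∧ B.card = t := by
  refine ⟨1000, by norm_num, 4, fun n hn t ht ht' => ?_⟩
  obtain ⟨x, rfl⟩ := Nat.exists_eq_add_of_le ht
  have hx : (x : ℝ) ≤ (n - 2 + x : ℕ) := by exact_mod_cast Nat.le_add_left _ _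
  obtain ⟨B, hB, hc⟩ := Attains.of_le hn (x := x) (le_max_of_le_right (hx.trans ht'))
  refine ⟨_, hB.isSaturatedBlocker, ?_⟩
  rw [Finset.card_image_of_injOn hB.injOn_chord]
  omega
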